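/- Fix s ∈ (0,1] and let (w₁,w₂,w₃) be a probability vector over three outcomes. Then for each i ∈ {1,2,3} (with (i,j,k) a permutation of (1,2,3)): s√(w_i) + (1 − √(1−s²))√(w_j w_k) ≤ s, with equality if and only if w_i = 1. Consequently max_i [s√(w_i) + (1 − √(1−s²))√(w_j w_k)] ≤ s, with equality only when some w_i equals 1. -/

import Mathlib

theorem one_sub_sqrt_one_sub_sq_le {s : ℝ} (hs0 : 0 ≤ s) (hs1 : s ≤ 1) :
    1 - √(1 - s ^ 2) ≤ s := by
  have h : 1 - s ≤ √(1 - s ^ 2) := Real.le_sqrt_of_sq_le (by nlinarith)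
  linarith

/-- The left-hand side falls short of `s` by at least `s / 2 * (1 - √x) ^ 2`. -/
theorem mul_sqrt_add_mul_sqrt_mul_le {s x y z : ℝ} (hs0 : 0 ≤ s) (hs1 : s ≤ 1)
    (hx : 0 ≤ x) (hy : 0 ≤ y) (hz : 0 ≤ z) (hsum : x + y + z = 1) :
    s * √x + (1 - √(1 - s ^ 2)) * √(y * z) ≤ s - s / 2 * (1 - √x) ^ 2 := by
  have hyz : √(y * z) ≤ (y + z) / 2 :=
    Real.sqrt_le_iff.mpr ⟨by positivity, by nlinarith [sq_nonneg (y - z)]⟩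
  calc s * √x + (1 - √(1 - s ^ 2)) * √(y * z)
      ≤ s * √x + s * ((y + z) / 2) := by
        gcongr
        exact one_sub_sqrt_one_sub_sq_le hs0 hs1
    _ = s - s / 2 * (1 - √x) ^ 2 := by
        linear_combination s / 2 * hsum + s / 2 * Real.sq_sqrt hx

theorem mul_sqrt_add_mul_sqrt_mul_le_and_eq_iff {s x y z : ℝ} (hs0 : 0 < s) (hs1 : s ≤ 1)
    (hx : 0 ≤ x) (hy : 0 ≤ y) (hz : 0 ≤ z) (hsum : x + y + z = 1) :
    s * √x + (1 - √(1 - s ^ 2)) * √(y * z) ≤ s ∧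
      (s * √x + (1 - √(1 - s ^ 2)) * √(y * z) = s ↔ x = 1) := by
  have h := mul_sqrt_add_mul_sqrt_mul_le hs0.le hs1 hx hy hz hsum
  have hgap : 0 ≤ s / 2 * (1 - √x) ^ 2 := by positivity
  refine ⟨by linarith, fun heq => ?_, fun hx1 => ?_⟩
  · have hzero : s / 2 * (1 - √x) ^ 2 = 0 := by linarith
    have hsq : (1 - √x) ^ 2 = 0 := (mul_eq_zero.mp hzero).resolve_left (by positivity)
    have hsqrt : 1 - √x = 0 := pow_eq_zero_iff two_ne_zero |>.mp hsq
    exact Real.sqrt_eq_one.mp (by linarith)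
  · have hy0 : y = 0 := by linarith
    simp [hx1, hy0]

/-- Fix `s ∈ (0,1]` and a probability vector `(w₁,w₂,w₃)`. Then for each
`i ∈ {1,2,3}` (with `(i,j,k)` a permutation of `(1,2,3)`):
`s√(wᵢ) + (1 − √(1−s²))√(wⱼwₖ) ≤ s`, with equality iff `wᵢ = 1`. Consequently the
maximum of these three quantities is at most `s`, with equality only when some `wᵢ = 1`. -/
theorem face_Pi_le_s (s w₁ w₂ w₃ : ℝ)
    (hs0 : 0 < s) (hs1 : s ≤ 1)
    (hw₁ : 0 ≤ w₁) (hw₂ : 0 ≤ w₂) (hw₃ : 0 ≤ w₃)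
    (hwsum : w₁ + w₂ + w₃ = 1)
    (e₁ e₂ e₃ : ℝ)
    (he₁ : e₁ = s * Real.sqrt w₁ + (1 - Real.sqrt (1 - s ^ 2)) * Real.sqrt (w₂ * w₃))
    (he₂ : e₂ = s * Real.sqrt w₂ + (1 - Real.sqrt (1 - s ^ 2)) * Real.sqrt (w₁ * w₃))
    (he₃ : e₃ = s * Real.sqrt w₃ + (1 - Real.sqrt (1 - s ^ 2)) * Real.sqrt (w₁ * w₂)) :
    (e₁ ≤ s ∧ (e₁ = s ↔ w₁ = 1)) ∧
    (e₂ ≤ s ∧ (e₂ = s ↔ w₂ = 1)) ∧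
    (e₃ ≤ s ∧ (e₃ = s ↔ w₃ = 1)) ∧
    (max (max e₁ e₂) e₃ ≤ s ∧
      (max (max e₁ e₂) e₃ = s → w₁ = 1 ∨ w₂ = 1 ∨ w₃ = 1)) := by
  have h₁ := mul_sqrt_add_mul_sqrt_mul_le_and_eq_iff hs0 hs1 hw₁ hw₂ hw₃ hwsum
  have h₂ := mul_sqrt_add_mul_sqrt_mul_le_and_eq_iff hs0 hs1 hw₂ hw₁ hw₃ (by linarith)
  have h₃ := mul_sqrt_add_mul_sqrt_mul_le_and_eq_iff hs0 hs1 hw₃ hw₁ hw₂ (by linarith)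
  rw [← he₁] at h₁
  rw [← he₂] at h₂
  rw [← he₃] at h₃
  refine ⟨h₁, h₂, h₃, max_le (max_le h₁.1 h₂.1) h₃.1, fun hmax => ?_⟩
  rw [← h₁.2, ← h₂.2, ← h₃.2]
  rcases max_choice (max e₁ e₂) e₃ with h | h
  · rcases max_choice e₁ e₂ with h' | h'
    · exact Or.inl (by rw [← hmax, h, h'])
    · exact Or.inr (Or.inl (by rw [← hmax, h, h']))
  · exact Or.inr (Or.inr (by rw [← hmax, h]))
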